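/- Let 1 ≤ ℓ ≤ m−1, let W be an (m−1)-dimensional subspace of V, and let Π be a hyperplane of the Plücker projective space P(⋀^ℓ V), determined by the nonzero functional φ, such that |{L ∈ G(ℓ,W) : L lies on Π}| = [m−1 ℓ]_q − q^{ℓ(m−1−ℓ)}. Then there exists an ordered basis w₁, …, w_m of V such that w₁, …, w_{m−1} is a basis of W, φ(w_{α₁} ∧ ⋯ ∧ w_{α_ℓ}) = 0 for every index tuple 1 ≤ α₁ < ⋯ < α_ℓ ≤ m−1 with (α₁, …, α_ℓ) ≠ (m−ℓ, m−ℓ+1, …, m−1), and φ(w_{m−ℓ} ∧ w_{m−ℓ+1} ∧ ⋯ ∧ w_{m−1}) ≠ 0. -/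

import Mathlib

open Module

/-- The Gaussian binomial coefficient `[m ℓ]_q`, as a rational number. -/
noncomputable def gaussBinom (q m l : ℕ) : ℚ :=
  ∏ i ∈ Finset.range l, ((q : ℚ) ^ (m - i) - 1) / ((q : ℚ) ^ (i + 1) - 1)

/-- `e(ℓ,m) = [m ℓ]_q − q^{ℓ(m−ℓ)}`. -/
noncomputable def eG (q l m : ℕ) : ℚ :=
  gaussBinom q m l - (q : ℚ) ^ (l * (m - l))

/-- `e'(ℓ,m) = [m ℓ]_q − q^{ℓ(m−ℓ)} − q^{ℓ(m−ℓ)−2}`. -/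
noncomputable def eG' (q l m : ℕ) : ℚ :=
  gaussBinom q m l - (q : ℚ) ^ (l * (m - l)) - (q : ℚ) ^ (l * (m - l) - 2)

variable (F : Type*) [Field F] (V : Type*) [AddCommGroup V] [Module F V]

/-- The wedge product `v₁ ∧ ⋯ ∧ vₙ` as an element of the `n`-th exterior power. -/
noncomputable def wedge (n : ℕ) (v : Fin n → V) : ⋀[F]^n V :=
  ⟨ExteriorAlgebra.ιMulti F n v, ExteriorAlgebra.ιMulti_range F n (Set.mem_range_self v)⟩

/-- The product `w₁ ∧ ⋯ ∧ w_k ∧ x` for `x` in the `l`-th exterior power, landing in the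
`n`-th exterior power, where `k + l = n`. -/
noncomputable def mulWedge (k l n : ℕ) (h : k + l = n) (w : Fin k → V) (x : ⋀[F]^l V) :
    ⋀[F]^n V :=
  ⟨ExteriorAlgebra.ιMulti F k w * (x : ExteriorAlgebra F V), by
    subst h
    have hmem : ExteriorAlgebra.ιMulti F k w * (x : ExteriorAlgebra F V) ∈
        (LinearMap.range (ExteriorAlgebra.ι F : V →ₗ[F] ExteriorAlgebra F V)) ^ k *
          (LinearMap.range (ExteriorAlgebra.ι F : V →ₗ[F] ExteriorAlgebra F V)) ^ l :=
      Submodule.mul_mem_mul (ExteriorAlgebra.ιMulti_range F k (Set.mem_range_self w)) x.2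
    rw [← pow_add] at hmem
    exact hmem⟩

/-- An `ℓ`-dimensional subspace `L` of `V` lies on the hyperplane of the Plücker projective
space determined by the nonzero functional `φ : ⋀[F]^ℓ V →ₗ[F] F` if
`φ (ω₁ ∧ ⋯ ∧ ω_ℓ) = 0` for some (equivalently, every) basis `ω₁, …, ω_ℓ` of `L`. -/
def LiesOn (l : ℕ) (φ : ⋀[F]^l V →ₗ[F] F) (L : Submodule F V) : Prop :=
  ∃ ω : Fin l → V, (∀ i, ω i ∈ L) ∧ LinearIndependent F ω ∧
    Submodule.span F (Set.range ω) = L ∧ φ (wedge F V l ω) = 0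

/-- The hyperplane determined by `φ : ⋀[F]^ℓ V →ₗ[F] F` is decomposable if there exist vectors
`w₁, …, w_{m−ℓ} ∈ V` and a nonzero linear functional `ψ : ⋀[F]^m V →ₗ[F] F` such that
`φ x = ψ (w₁ ∧ ⋯ ∧ w_{m−ℓ} ∧ x)` for all `x ∈ ⋀[F]^ℓ V`. -/
def IsDecomposable (m l : ℕ) (h : l ≤ m) (φ : ⋀[F]^l V →ₗ[F] F) : Prop :=
  ∃ (w : Fin (m - l) → V) (ψ : ⋀[F]^m V →ₗ[F] F), ψ ≠ 0 ∧
    ∀ x : ⋀[F]^l V, φ x = ψ (mulWedge F V (m - l) l m (Nat.sub_add_cancel h) w x)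

section NonvanishingTuples

variable {K M : Type*} [Field K] [AddCommGroup M] [Module K M]

/-- If `f` does not vanish at `v`, then the vectors `v` are linearly independent modulo the
radical of `f`. -/
theorem eq_zero_of_sum_mem_ker_curryLeft {p : ℕ} (f : M [⋀^Fin (p + 1)]→ₗ[K] K)
    {v : Fin (p + 1) → M} (hv : f v ≠ 0) (c : Fin (p + 1) → K)
    (hc : ∑ i, c i • v i ∈ LinearMap.ker f.curryLeft) (j : Fin (p + 1)) : c j = 0 := by
  have hrad : f (Function.update v j (∑ i, c i • v i)) = 0 := by
    have h0 : ∀ u : Fin (p + 1) → M, u 0 = ∑ i, c i • v i → f u = 0 := by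
      intro u hu
      have h := DFunLike.congr_fun (LinearMap.mem_ker.1 hc) (Matrix.vecTail u)
      rw [← hu, AlternatingMap.curryLeft_apply_apply] at h
      exact (congrArg f (Matrix.cons_head_tail u)).symm.trans h
    have hs := f.map_perm (Function.update v j (∑ i, c i • v i)) (Equiv.swap 0 j)
    rw [h0 _ (by simp)] at hs
    by_contra hne
    rcases Int.units_eq_one_or (Equiv.Perm.sign (Equiv.swap 0 j)) with h | h <;>
      rw [h] at hs <;> simp_all
  rw [f.map_update_sum] at hrad
  rw [Finset.sum_eq_single j] at hrad
  · simpa [hv] using hrad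
  · intro i _ hij
    rw [f.map_update_smul, f.map_update_self v hij.symm, smul_zero]
  · simp

theorem finrank_ker_curryLeft_add_le [FiniteDimensional K M] {p : ℕ}
    {f : M [⋀^Fin (p + 1)]→ₗ[K] K} (hf : f ≠ 0) :
    finrank K (LinearMap.ker f.curryLeft) + (p + 1) ≤ finrank K M := by
  obtain ⟨v, hv⟩ : ∃ v, f v ≠ 0 := by
    by_contra! h
    exact hf (AlternatingMap.ext h)
  have hli : LinearIndependent K ((LinearMap.ker f.curryLeft).mkQ ∘ v) := by
    rw [Fintype.linearIndependent_iff]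
    intro c hc
    refine eq_zero_of_sum_mem_ker_curryLeft f hv c ?_
    rw [← Submodule.ker_mkQ (LinearMap.ker f.curryLeft), LinearMap.mem_ker]
    simpa using hc
  have h1 := hli.fintype_card_le_finrank
  have h2 := Submodule.finrank_quotient_add_finrank (LinearMap.ker f.curryLeft)
  rw [Fintype.card_fin] at h1
  omega

theorem natCard_ne_zero_eq_sum [Fintype M] {p : ℕ} (f : M [⋀^Fin (p + 1)]→ₗ[K] K) :
    Nat.card {v : Fin (p + 1) → M // f v ≠ 0} =
      ∑ x : M, Nat.card {u : Fin p → M // f.curryLeft x u ≠ 0} := by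
  rw [← Nat.card_sigma]
  refine Nat.card_congr ?_
  exact
    { toFun := fun v => ⟨v.1 0, Matrix.vecTail v.1, by
        rw [AlternatingMap.curryLeft_apply_apply]
        exact (congrArg f (Matrix.cons_head_tail v.1)).trans_ne v.2⟩
      invFun := fun y => ⟨Matrix.vecCons y.1 y.2.1, y.2.2⟩
      left_inv := fun v => Subtype.ext (Matrix.cons_head_tail v.1)
      right_inv := fun y => rfl }

theorem natCard_compl_mul_le_natCard_ne_zero [Fintype K] [Fintype M] {p B : ℕ}
    (f : M [⋀^Fin (p + 1)]→ₗ[K] K)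
    (hB : ∀ g : M [⋀^Fin p]→ₗ[K] K, g ≠ 0 → B ≤ Nat.card {u : Fin p → M // g u ≠ 0}) :
    (Fintype.card K ^ finrank K M -
      Fintype.card K ^ finrank K (LinearMap.ker f.curryLeft)) * B ≤
        Nat.card {v : Fin (p + 1) → M // f v ≠ 0} := by
  classical
  have hker : (Finset.univ.filter fun x => f.curryLeft x ≠ 0).card =
      Fintype.card K ^ finrank K M -
        Fintype.card K ^ finrank K (LinearMap.ker f.curryLeft) := by
    have h := Finset.card_filter_add_card_filter_not (s := Finset.univ)
      (fun x => f.curryLeft x = 0)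
    rw [Finset.card_univ, Module.card_eq_pow_finrank (K := K)] at h
    have h2 : (Finset.univ.filter fun x => f.curryLeft x = 0).card =
        Fintype.card K ^ finrank K (LinearMap.ker f.curryLeft) := by
      rw [← Module.card_eq_pow_finrank, ← Fintype.card_subtype]
      exact Fintype.card_congr (Equiv.refl _)
    simp only [ne_eq]
    omega
  rw [natCard_ne_zero_eq_sum, ← hker, ← smul_eq_mul]
  exact (Finset.card_nsmul_le_sum _ _ _ fun x hx => hB _ (Finset.mem_filter.1 hx).2).trans
    (Finset.sum_le_sum_of_subset (Finset.subset_univ _))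

/-- A nonzero alternating form has at least as many nonvanishing tuples as a decomposable one. -/
theorem prod_le_natCard_ne_zero [Fintype K] [Fintype M] {p : ℕ} (f : M [⋀^Fin p]→ₗ[K] K)
    (hf : f ≠ 0) :
    ∏ i ∈ Finset.range p,
      (Fintype.card K ^ finrank K M - Fintype.card K ^ (finrank K M - 1 - i)) ≤
        Nat.card {v : Fin p → M // f v ≠ 0} := by
  induction p with
  | zero =>
    obtain ⟨v, hv⟩ : ∃ v, f v ≠ 0 := by
      by_contra! h
      exact hf (AlternatingMap.ext h)
    have : Nonempty {v : Fin 0 → M // f v ≠ 0} := ⟨⟨v, hv⟩⟩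
    rw [Finset.range_zero, Finset.prod_empty]
    exact Nat.card_pos
  | succ p ih =>
    refine le_trans ?_ (natCard_compl_mul_le_natCard_ne_zero f ih)
    rw [Finset.prod_range_succ, mul_comm]
    have := finrank_ker_curryLeft_add_le hf
    gcongr
    · exact Fintype.card_pos
    · omega

/-- A nonzero alternating form with the least number of nonvanishing tuples has a radical of the
largest possible dimension. -/
theorem finrank_ker_curryLeft_of_natCard_eq [Fintype K] [Fintype M] {p : ℕ}
    (f : M [⋀^Fin (p + 1)]→ₗ[K] K) (hf : f ≠ 0)
    (hcard : Nat.card {v : Fin (p + 1) → M // f v ≠ 0} =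
      ∏ i ∈ Finset.range (p + 1),
        (Fintype.card K ^ finrank K M - Fintype.card K ^ (finrank K M - 1 - i))) :
    finrank K (LinearMap.ker f.curryLeft) + (p + 1) = finrank K M := by
  have hle := finrank_ker_curryLeft_add_le hf
  have h := natCard_compl_mul_le_natCard_ne_zero f prod_le_natCard_ne_zero
  have hK : 1 < Fintype.card K := Fintype.one_lt_card
  rw [hcard, Finset.prod_range_succ, mul_comm] at h
  have hpos : 0 < ∏ i ∈ Finset.range p,
      (Fintype.card K ^ finrank K M - Fintype.card K ^ (finrank K M - 1 - i)) :=
    Finset.prod_pos fun i _ => Nat.sub_pos_of_lt (Nat.pow_lt_pow_right hK (by omega))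
  have h' := Nat.le_of_mul_le_mul_left h hpos
  have h1 : Fintype.card K ^ (finrank K M - 1 - p) < Fintype.card K ^ finrank K M :=
    Nat.pow_lt_pow_right hK (by omega)
  have h2 : Fintype.card K ^ finrank K (LinearMap.ker f.curryLeft) <
      Fintype.card K ^ finrank K M := Nat.pow_lt_pow_right hK (by omega)
  have h3 := (Nat.pow_le_pow_iff_right hK).1 (show Fintype.card K ^ (finrank K M - 1 - p) ≤
    Fintype.card K ^ finrank K (LinearMap.ker f.curryLeft) by omega)
  omega

end NonvanishingTuples

section SubspaceCount

variable {K M : Type*} [Field K] [AddCommGroup M] [Module K M]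

/-- Every `l`-dimensional subspace has the same number of ordered bases. -/
theorem natCard_linearIndependent_span_mem [Fintype K] [Fintype M] {l : ℕ}
    (S : Set (Submodule K M)) (hS : ∀ L ∈ S, finrank K L = l) :
    Nat.card {v : Fin l → M // LinearIndependent K v ∧ Submodule.span K (Set.range v) ∈ S} =
      Nat.card S * ∏ i ∈ Finset.range l, (Fintype.card K ^ l - Fintype.card K ^ i) := by
  classical
  have : Fintype S := Fintype.ofFinite S
  have hspan : ∀ (L : S) (u : Fin l → L.1), LinearIndependent K u →
      Submodule.span K (Set.range fun i => (u i : M)) = L.1 := by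
    intro L u hu
    have h := hu.span_eq_top_of_card_eq_finrank' (by simp [hS L.1 L.2])
    have h' := congrArg (Submodule.map L.1.subtype) h
    rwa [Submodule.map_span, ← Set.range_comp, Submodule.map_top, Submodule.range_subtype] at h'
  let e : (Σ L : S, {u : Fin l → L.1 // LinearIndependent K u}) →
      {v : Fin l → M // LinearIndependent K v ∧ Submodule.span K (Set.range v) ∈ S} :=
    fun y => ⟨fun i => (y.2.1 i : M), y.2.2.map' y.1.1.subtype (Submodule.ker_subtype _),
      by rw [hspan y.1 y.2.1 y.2.2]; exact y.1.2⟩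
  have he : Function.Bijective e := by
    constructor
    · rintro ⟨L, u, hu⟩ ⟨L', u', hu'⟩ h
      have hv : (fun i => (u i : M)) = fun i => (u' i : M) := congrArg Subtype.val h
      obtain rfl : L = L' := Subtype.ext (by rw [← hspan L u hu, hv, hspan L' u' hu'])
      obtain rfl : u = u' := funext fun i => Subtype.ext (congrFun hv i)
      rfl
    · rintro ⟨v, hv, hvS⟩
      exact ⟨⟨⟨_, hvS⟩, fun i => ⟨v i, Submodule.subset_span (Set.mem_range_self i)⟩,
        LinearIndependent.of_comp (Submodule.subtype _) hv⟩, rfl⟩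
  rw [← Nat.card_eq_of_bijective e he, Nat.card_sigma, Nat.card_eq_fintype_card,
    Finset.sum_congr rfl (g := fun _ => ∏ i ∈ Finset.range l,
      (Fintype.card K ^ l - Fintype.card K ^ i))]
  · simp
  · intro L _
    rw [card_linearIndependent (hS L.1 L.2).ge, hS L.1 L.2, Finset.prod_range]

theorem natCard_linearIndependent_span_mem_of_le [Fintype K] [Fintype M] {l : ℕ}
    (N : Submodule K M) (S : Set (Submodule K M)) (hS : ∀ L ∈ S, finrank K L = l ∧ L ≤ N) :
    Nat.card {u : Fin l → N // LinearIndependent K u ∧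
      Submodule.span K (Set.range (N.subtype ∘ u)) ∈ S} =
      Nat.card S * ∏ i ∈ Finset.range l, (Fintype.card K ^ l - Fintype.card K ^ i) := by
  rw [← natCard_linearIndependent_span_mem S fun L hL => (hS L hL).1]
  refine Nat.card_eq_of_bijective
    (fun u => ⟨N.subtype ∘ u.1, u.2.1.map' _ (Submodule.ker_subtype _), u.2.2⟩) ⟨?_, ?_⟩
  · intro u u' h
    exact Subtype.ext (N.injective_subtype.comp_left (congrArg Subtype.val h))
  · rintro ⟨v, hv, hvS⟩
    have hvN : ∀ i, v i ∈ N := fun i =>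
      (hS _ hvS).2 (Submodule.subset_span (Set.mem_range_self i))
    exact ⟨⟨fun i => ⟨v i, hvN i⟩, LinearIndependent.of_comp N.subtype hv, hvS⟩, rfl⟩

theorem pow_mul_prod_pow_sub_pow (q n l : ℕ) (h : l ≤ n) :
    q ^ (l * (n - l)) * ∏ i ∈ Finset.range l, (q ^ l - q ^ i) =
      ∏ i ∈ Finset.range l, (q ^ n - q ^ (n - 1 - i)) := by
  have hpow : q ^ (l * (n - l)) = ∏ _i ∈ Finset.range l, q ^ (n - l) := by
    rw [Finset.prod_const, Finset.card_range, ← pow_mul, mul_comm]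
  rw [hpow, ← Finset.prod_mul_distrib,
    ← Finset.prod_range_reflect (fun i => q ^ n - q ^ (n - 1 - i))]
  refine Finset.prod_congr rfl fun i hi => ?_
  have := Finset.mem_range.1 hi
  rw [Nat.mul_sub, ← pow_add, ← pow_add]
  congr 2 <;> omega

theorem gaussBinom_mul_prod (q n l : ℕ) (hq : 1 < q) (h : l ≤ n) :
    gaussBinom q n l * ((∏ i ∈ Finset.range l, (q ^ l - q ^ i) : ℕ) : ℚ) =
      ((∏ i ∈ Finset.range l, (q ^ n - q ^ i) : ℕ) : ℚ) := by
  have hq' : (1 : ℚ) < q := by exact_mod_cast hq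
  have key : ∀ k, l ≤ k → ((∏ i ∈ Finset.range l, (q ^ k - q ^ i) : ℕ) : ℚ) =
      (∏ i ∈ Finset.range l, (q : ℚ) ^ i) * ∏ i ∈ Finset.range l, ((q : ℚ) ^ (k - i) - 1) := by
    intro k hk
    rw [Nat.cast_prod, ← Finset.prod_mul_distrib]
    refine Finset.prod_congr rfl fun i hi => ?_
    have hi' : i ≤ k := by have := Finset.mem_range.1 hi; omega
    rw [Nat.cast_sub (Nat.pow_le_pow_right hq.le hi'), mul_sub, ← pow_add,
      Nat.add_sub_cancel' hi']
    simp
  have hrefl : ∏ i ∈ Finset.range l, ((q : ℚ) ^ (l - i) - 1) =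
      ∏ i ∈ Finset.range l, ((q : ℚ) ^ (i + 1) - 1) := by
    rw [← Finset.prod_range_reflect (fun i => (q : ℚ) ^ (i + 1) - 1)]
    refine Finset.prod_congr rfl fun i hi => ?_
    have := Finset.mem_range.1 hi
    rw [show l - 1 - i + 1 = l - i by omega]
  have hne : ∏ i ∈ Finset.range l, ((q : ℚ) ^ (i + 1) - 1) ≠ 0 :=
    Finset.prod_ne_zero_iff.2 fun i _ => (sub_pos.2 (one_lt_pow₀ hq' (by omega))).ne'
  rw [key l le_rfl, key n h, hrefl, gaussBinom, Finset.prod_div_distrib]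
  field_simp

end SubspaceCount

section AdaptedBasis

variable {K M : Type*} [Field K] [AddCommGroup M] [Module K M]

theorem exists_basis_extending [FiniteDimensional K M] {k j : ℕ} (N : Submodule K M)
    (b : Basis (Fin k) K N) (hM : finrank K M = k + j) :
    ∃ c : Basis (Fin (k + j)) K M, ∀ i, c (Fin.castAdd j i) = b i := by
  obtain ⟨C, hC⟩ := N.exists_isCompl
  have hCj : finrank K C = j := by
    have h1 := Submodule.finrank_add_eq_of_isCompl hC
    have h2 := finrank_eq_card_basis b
    rw [Fintype.card_fin] at h2
    omega
  refine ⟨((b.prod (finBasisOfFinrankEq K C hCj)).map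
    (Submodule.prodEquivOfIsCompl N C hC)).reindex finSumFinEquiv, fun i => ?_⟩
  simp

/-- A nonzero form whose radical has dimension `k` does not vanish on a complement of it. -/
theorem map_basis_natAdd_ne_zero {k p : ℕ} {f : M [⋀^Fin (p + 1)]→ₗ[K] K} (hf : f ≠ 0)
    (b : Basis (Fin (k + (p + 1))) K M)
    (hb : ∀ v : Fin (p + 1) → Fin (k + (p + 1)), (∃ i, (v i : ℕ) < k) → f (b ∘ v) = 0) :
    f (b ∘ Fin.natAdd k) ≠ 0 := by
  intro h0
  refine hf (b.ext_alternating fun v hv => ?_)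
  change f (b ∘ v) = 0
  by_cases hex : ∃ i, (v i : ℕ) < k
  · exact hb v hex
  · push Not at hex
    let s : Fin (p + 1) → Fin (p + 1) := fun i => ⟨v i - k, by have := (v i).2; omega⟩
    have hvs : ∀ i, v i = Fin.natAdd k (s i) := fun i => Fin.ext (by
      have := hex i
      simp [s]
      omega)
    have hs : Function.Injective s := fun i j hij => hv (by rw [hvs i, hvs j, hij])
    let σ := Equiv.ofBijective s (Finite.injective_iff_bijective.1 hs)
    have : b ∘ v = (b ∘ Fin.natAdd k) ∘ σ := funext fun i => congrArg b (hvs i)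
    rw [this, f.map_perm, h0, smul_zero]

theorem map_eq_zero_of_mem_ker_curryLeft {p : ℕ} (f : M [⋀^Fin (p + 1)]→ₗ[K] K)
    {u : Fin (p + 1) → M} (j : Fin (p + 1)) (hj : u j ∈ LinearMap.ker f.curryLeft) :
    f u = 0 := by
  by_contra hne
  have h := eq_zero_of_sum_mem_ker_curryLeft f hne (Pi.single j 1)
    (by simpa [Pi.single_apply] using hj) j
  simp at h

end AdaptedBasis

section PluckerHyperplane

variable {K M : Type*} [Field K] [AddCommGroup M] [Module K M]

/-- The alternating form on `N` obtained by restricting a functional on `⋀[K]^l M`. -/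
noncomputable def plueckerForm {l : ℕ} (φ : ⋀[K]^l M →ₗ[K] K) (N : Submodule K M) :
    N [⋀^Fin l]→ₗ[K] K :=
  (φ.compAlternatingMap (exteriorPower.ιMulti K l)).compLinearMap N.subtype

theorem plueckerForm_apply {l : ℕ} (φ : ⋀[K]^l M →ₗ[K] K) (N : Submodule K M) (u : Fin l → N) :
    plueckerForm φ N u = φ (wedge K M l (N.subtype ∘ u)) :=
  rfl

/-- Whether a subspace lies on a Plücker hyperplane can be tested on any basis. -/
theorem liesOn_span_iff {l : ℕ} (φ : ⋀[K]^l M →ₗ[K] K) {v : Fin l → M}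
    (hv : LinearIndependent K v) :
    LiesOn K M l φ (Submodule.span K (Set.range v)) ↔ φ (wedge K M l v) = 0 := by
  have test : ∀ {ω : Fin l → M} (hω : LinearIndependent K ω) (N : Submodule K M),
      Submodule.span K (Set.range ω) = N → (φ (wedge K M l ω) = 0 ↔ plueckerForm φ N = 0) := by
    rintro ω hω N rfl
    rw [← (plueckerForm φ _).map_basis_eq_zero_iff (Basis.span hω), plueckerForm_apply]
    have : (Submodule.span K (Set.range ω)).subtype ∘ Basis.span hω = ω :=
      funext fun i => congrArg Subtype.val (Basis.span_apply hω i)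
    rw [this]
  constructor
  · rintro ⟨ω, -, hω, hspan, h0⟩
    rwa [test hv _ rfl, ← test hω _ hspan]
  · exact fun h => ⟨v, fun i => Submodule.subset_span (Set.mem_range_self i), hv, rfl, h⟩

theorem natCard_plueckerForm_ne_zero [Fintype K] [Fintype M] {l : ℕ}
    (φ : ⋀[K]^l M →ₗ[K] K) (N : Submodule K M) :
    Nat.card {u : Fin l → N // plueckerForm φ N u ≠ 0} =
      Nat.card {L : Submodule K M | (finrank K L = l ∧ L ≤ N) ∧ ¬ LiesOn K M l φ L} *
        ∏ i ∈ Finset.range l, (Fintype.card K ^ l - Fintype.card K ^ i) := by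
  rw [← natCard_linearIndependent_span_mem_of_le N _ fun L hL => hL.1]
  refine Nat.card_congr (Equiv.subtypeEquivRight fun u => ?_)
  constructor
  · intro h
    have hu : LinearIndependent K u := by
      by_contra hu
      exact h ((plueckerForm φ N).map_linearDependent u hu)
    have hu' := hu.map' N.subtype N.ker_subtype
    refine ⟨hu, ⟨?_, ?_⟩, ?_⟩
    · rw [finrank_span_eq_card hu', Fintype.card_fin]
    · rw [Submodule.span_le]
      rintro _ ⟨i, rfl⟩
      exact (u i).2
    · rwa [liesOn_span_iff φ hu', ← plueckerForm_apply]
  · rintro ⟨hu, -, h⟩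
    rwa [liesOn_span_iff φ (hu.map' N.subtype N.ker_subtype), ← plueckerForm_apply] at h

theorem natCard_finrank_eq_and_le [Fintype K] [Fintype M] {l : ℕ} (N : Submodule K M)
    (hl : l ≤ finrank K N) :
    (Nat.card {L : Submodule K M | finrank K L = l ∧ L ≤ N} : ℚ) =
      gaussBinom (Fintype.card K) (finrank K N) l := by
  have hK : 1 < Fintype.card K := Fintype.one_lt_card
  have h := natCard_linearIndependent_span_mem_of_le (l := l) N
    {L : Submodule K M | finrank K L = l ∧ L ≤ N} fun L hL => hL
  have hall : Nat.card {u : Fin l → N // LinearIndependent K u ∧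
      Submodule.span K (Set.range (N.subtype ∘ u)) ∈
        {L : Submodule K M | finrank K L = l ∧ L ≤ N}} =
      Nat.card {u : Fin l → N // LinearIndependent K u} := by
    refine Nat.card_congr (Equiv.subtypeEquivRight fun u => and_iff_left_of_imp fun hu => ⟨?_, ?_⟩)
    · rw [finrank_span_eq_card (hu.map' N.subtype N.ker_subtype), Fintype.card_fin]
    · rw [Submodule.span_le]
      rintro _ ⟨i, rfl⟩
      exact (u i).2
  rw [hall, card_linearIndependent hl, ← Finset.prod_range
    (fun i => Fintype.card K ^ finrank K N - Fintype.card K ^ i)] at h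
  have hpos : ∏ i ∈ Finset.range l, (Fintype.card K ^ l - Fintype.card K ^ i) ≠ 0 :=
    Finset.prod_ne_zero_iff.2 fun i hi =>
      (Nat.sub_pos_of_lt (Nat.pow_lt_pow_right hK (Finset.mem_range.1 hi))).ne'
  refine mul_right_cancel₀ (Nat.cast_ne_zero.2 hpos) ?_
  rw [gaussBinom_mul_prod _ _ _ hK hl, h, Nat.cast_mul]

theorem natCard_not_liesOn_eq [Fintype K] [Fintype M] {l : ℕ} (φ : ⋀[K]^l M →ₗ[K] K)
    (N : Submodule K M) (hl : l ≤ finrank K N) {c : ℕ}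
    (hcard : (Nat.card {L : Submodule K M | finrank K L = l ∧ L ≤ N ∧ LiesOn K M l φ L} : ℚ) =
      gaussBinom (Fintype.card K) (finrank K N) l - c) :
    Nat.card {L : Submodule K M | (finrank K L = l ∧ L ≤ N) ∧ ¬ LiesOn K M l φ L} = c := by
  have hsum := Set.ncard_inter_add_ncard_sdiff_eq_ncard
    {L : Submodule K M | finrank K L = l ∧ L ≤ N} {L | LiesOn K M l φ L}
  have htot := natCard_finrank_eq_and_le N hl
  simp only [Nat.card_coe_set_eq] at hcard htot ⊢
  rw [← htot, ← hsum] at hcard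
  have hset : {L : Submodule K M | finrank K L = l ∧ L ≤ N} ∩ {L | LiesOn K M l φ L} =
      {L : Submodule K M | finrank K L = l ∧ L ≤ N ∧ LiesOn K M l φ L} := by
    ext L
    simp [and_assoc]
  rw [hset] at hcard
  push_cast at hcard
  have h : (({L : Submodule K M | finrank K L = l ∧ L ≤ N} \ {L | LiesOn K M l φ L}).ncard : ℚ) =
      c := by linarith
  exact_mod_cast h

end PluckerHyperplane

/-- If a hyperplane `Π` of `P(⋀^ℓ V)`, determined by the nonzero functional `φ`, meets
`G(ℓ,W)` in exactly `[m−1 ℓ]_q − q^{ℓ(m−1−ℓ)}` points for some `(m−1)`-dimensional subspace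
`W`, then there is an ordered basis `w₁, …, w_m` of `V` whose first `m−1` vectors form a basis
of `W`, such that `φ(w_{α₁} ∧ ⋯ ∧ w_{α_ℓ}) = 0` for every `1 ≤ α₁ < ⋯ < α_ℓ ≤ m−1` with
`(α₁,…,α_ℓ) ≠ (m−ℓ,…,m−1)`, and `φ(w_{m−ℓ} ∧ ⋯ ∧ w_{m−1}) ≠ 0`. -/
theorem stmt12 (F : Type*) [Field F] [Fintype F] (V : Type*) [AddCommGroup V] [Module F V]
    [FiniteDimensional F V] (q m l : ℕ) (hq : Fintype.card F = q)
    (hV : finrank F V = m) (hl : 1 ≤ l) (hlm : l ≤ m - 1)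
    (W : Submodule F V) (hW : finrank F W = m - 1)
    (φ : ⋀[F]^l V →ₗ[F] F) (hφ : φ ≠ 0)
    (hcard : (Nat.card {L : Submodule F V | finrank F L = l ∧ L ≤ W ∧ LiesOn F V l φ L} : ℚ)
      = gaussBinom q (m - 1) l - (q : ℚ) ^ (l * (m - 1 - l))) :
    ∃ w : Fin m → V, LinearIndependent F w ∧ Submodule.span F (Set.range w) = ⊤ ∧
      (∀ i : Fin m, (i : ℕ) < m - 1 → w i ∈ W) ∧
      Submodule.span F (w '' {i : Fin m | (i : ℕ) < m - 1}) = W ∧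
      (∀ α : Fin l → Fin m, StrictMono α → (∀ i, (α i : ℕ) < m - 1) →
        ¬ (∀ i : Fin l, (α i : ℕ) = m - l - 1 + (i : ℕ)) → φ (wedge F V l (w ∘ α)) = 0) ∧
      φ (wedge F V l (fun i : Fin l => w ⟨m - l - 1 + (i : ℕ), by omega⟩)) ≠ 0 := by
  obtain ⟨p, rfl⟩ : ∃ p, l = p + 1 := ⟨l - 1, by omega⟩
  subst hq
  have : Finite V := Module.finite_of_finite F
  have : Fintype V := Fintype.ofFinite V
  have : Fintype W := Fintype.ofFinite W
  have hlW : p + 1 ≤ finrank F W := by omega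
  rw [← hW] at hcard
  set f := plueckerForm φ W
  have hN : Nat.card {u : Fin (p + 1) → W // f u ≠ 0} = _ := natCard_plueckerForm_ne_zero φ W
  rw [natCard_not_liesOn_eq φ W hlW (by exact_mod_cast hcard),
    pow_mul_prod_pow_sub_pow _ _ _ hlW] at hN
  have hf : f ≠ 0 := by
    intro h0
    have hpos : 0 < ∏ i ∈ Finset.range (p + 1),
        (Fintype.card F ^ finrank F W - Fintype.card F ^ (finrank F W - 1 - i)) :=
      Finset.prod_pos fun i _ =>
        Nat.sub_pos_of_lt (Nat.pow_lt_pow_right Fintype.one_lt_card (by omega))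
    rw [← hN, h0] at hpos
    simp at hpos
  have hrad := finrank_ker_curryLeft_of_natCard_eq f hf hN
  obtain ⟨k, hk⟩ : ∃ k, finrank F (LinearMap.ker f.curryLeft) = k := ⟨_, rfl⟩
  rw [hk] at hrad
  obtain ⟨b, hb⟩ := exists_basis_extending _ (finBasisOfFinrankEq F _ hk) hrad.symm
  obtain rfl : m = k + (p + 1) + 1 := by omega
  obtain ⟨c, hc⟩ := exists_basis_extending W b hV
  have hker : ∀ i : Fin (k + (p + 1)), (i : ℕ) < k → b i ∈ LinearMap.ker f.curryLeft := by
    intro i hi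
    have := hb ⟨i, hi⟩
    rw [show Fin.castAdd (p + 1) ⟨i, hi⟩ = i from rfl] at this
    rw [this]
    exact Subtype.coe_prop _
  have hzero : ∀ v : Fin (p + 1) → Fin (k + (p + 1)), (∃ i, (v i : ℕ) < k) → f (b ∘ v) = 0 :=
    fun v ⟨i, hi⟩ => map_eq_zero_of_mem_ker_curryLeft f i (hker _ hi)
  have hcW : ∀ (i : Fin (k + (p + 1) + 1)) (hi : (i : ℕ) < k + (p + 1)), c i = b ⟨i, hi⟩ :=
    fun i hi => hc ⟨i, hi⟩
  refine ⟨c, c.linearIndependent, c.span_eq, fun i hi => ?_, ?_, fun α hα hαW hne => ?_, ?_⟩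
  · rw [hcW i hi]
    exact Subtype.coe_prop _
  · have himg : c '' {i | (i : ℕ) < k + (p + 1) + 1 - 1} = W.subtype '' Set.range b := by
      ext x
      constructor
      · rintro ⟨i, hi, rfl⟩
        exact ⟨b ⟨i, hi⟩, Set.mem_range_self _, (hcW i hi).symm⟩
      · rintro ⟨_, ⟨i, rfl⟩, rfl⟩
        exact ⟨Fin.castAdd 1 i, i.2, hc i⟩
    rw [himg, ← Submodule.map_span, b.span_eq, Submodule.map_top, Submodule.range_subtype]
  · have hcα : c ∘ α = W.subtype ∘ b ∘ fun i => ⟨α i, hαW i⟩ :=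
      funext fun i => hcW (α i) (hαW i)
    rw [hcα, ← plueckerForm_apply]
    refine hzero _ ?_
    by_contra! hge
    refine hne fun i => ?_
    let s : Fin (p + 1) → Fin (p + 1) := fun i => ⟨α i - k, by have := hαW i; omega⟩
    have hs : StrictMono s := fun i j hij => by
      have h1 : (α i : ℕ) < α j := hα hij
      have h2 : k ≤ (α i : ℕ) := hge i
      change (α i : ℕ) - k < α j - k
      omega
    have h1 : (α i : ℕ) - k = i := congrArg Fin.val (le_antisymm hs.apply_le hs.le_apply)
    have h2 : k ≤ (α i : ℕ) := hge i
    omega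
  · have hlast : (fun i : Fin (p + 1) => c ⟨k + (p + 1) + 1 - (p + 1) - 1 + (i : ℕ), by omega⟩) =
        W.subtype ∘ b ∘ Fin.natAdd k := by
      funext i
      rw [hcW _ (by simp; omega)]
      refine congrArg (fun j => (b j : V)) (Fin.ext ?_)
      simp
      omega
    rw [hlast, ← plueckerForm_apply]
    exact map_basis_natAdd_ne_zero hf b hzero
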